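/- Let M̃_n = M_n(t₋) where t₋(k) = −1 for all k, and let p_{n,k} denote the coefficient of z^k in the characteristic polynomial of M̃_n. Then for every i ≥ 0 and n ≥ 1, p_{i+n,i} = Σ_{j=0}^{n−1} C(i+j+1, i) · C(n−1, j), and p_{i,i} = 1 (where C(a,b) denotes the binomial coefficient). -/

import Mathlib

open Polynomial Matrix Finset

/-- The `n × n` upper Hessenberg Toeplitz matrix with entries `t (j - i + 1)` on and above
the diagonal (1-based indexing), `1` on the subdiagonal, and `0` below. -/
def uht (t : ℕ → ℤ) (n : ℕ) : Matrix (Fin n) (Fin n) ℤ :=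
  Matrix.of fun i j =>
    if (i : ℕ) ≤ (j : ℕ) then t ((j : ℕ) - (i : ℕ) + 1)
    else if (i : ℕ) = (j : ℕ) + 1 then 1 else 0

lemma uht_apply_succ_succ (t : ℕ → ℤ) (n : ℕ) (i j : Fin n) :
    uht t (n + 1) i.succ j.succ = uht t n i j := by
  simp [uht]

lemma charmatrix_uht_succ_succ (t : ℕ → ℤ) (n : ℕ) (i j : Fin n) :
    (uht t (n + 1)).charmatrix i.succ j.succ = (uht t n).charmatrix i j := by
  simp [charmatrix_apply, uht_apply_succ_succ, Matrix.diagonal_apply]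

lemma charpoly_uht_neg_one_succ_succ (n : ℕ) :
    (uht (fun _ => -1) (n + 2)).charpoly =
      (X + 2) * (uht (fun _ => -1) (n + 1)).charpoly - X * (uht (fun _ => -1) n).charpoly := by
  simp only [Matrix.charpoly]
  set A := (uht (fun _ => -1) (n + 2)).charmatrix with hA
  set B := A.updateRow 0 (A 0 + (-1 : ℤ[X]) • A 1) with hB
  have hdet : A.det = B.det := (det_updateRow_add_smul_self A (by simp) (-1)).symm
  have h00 : B 0 0 = X + 2 := by
    simp [hB, hA, uht]
    ring
  have h01 : B 0 1 = -X := by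
    simp [hB, hA, uht]
  have h0 (j : Fin n) : B 0 j.succ.succ = 0 := by
    have h1 : (1 : Fin (n + 2)) ≠ j.succ.succ := by simp [Fin.ext_iff]
    have h2 : (0 : Fin (n + 2)) ≠ j.succ.succ := by simp [Fin.ext_iff]
    have h3 : (1 : Fin (n + 2)) ≤ j.succ.succ := by simp [Fin.le_def]
    simp [hB, hA, uht, h1, h2, h3]
  have hB' (i : Fin (n + 1)) (j : Fin (n + 2)) : B i.succ j = A i.succ j := by
    simp [hB, updateRow_apply]
  have hm0 : B.submatrix Fin.succ (Fin.succAbove 0) = (uht (fun _ => -1) (n + 1)).charmatrix := by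
    ext1 i j
    simp [hB', hA, charmatrix_uht_succ_succ]
  have hm1 : (B.submatrix Fin.succ (Fin.succAbove 1)).det =
      -(uht (fun _ => -1) n).charmatrix.det := by
    rw [det_succ_column_zero, Fin.sum_univ_succ, Finset.sum_eq_zero, add_zero]
    · have hs : (B.submatrix Fin.succ (Fin.succAbove 1)).submatrix (Fin.succAbove 0) Fin.succ =
          (uht (fun _ => -1) n).charmatrix := by
        ext1 i j
        have hj : (Fin.succAbove (1 : Fin (n + 2)) j.succ) = j.succ.succ := by
          rw [← Fin.succ_zero_eq_one, Fin.succ_succAbove_succ, Fin.succAbove_zero]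
        simp [hB', hA, charmatrix_uht_succ_succ, hj]
      rw [hs]
      simp [hB, hA, uht]
    · intro i _
      simp [hB', hA, uht]
  rw [hdet, det_succ_row_zero, Fin.sum_univ_succ, Fin.sum_univ_succ]
  simp only [h0, Fin.succ_zero_eq_one, h00, h01, hm0, hm1]
  simp
  ring

/-- The binomial sum `∑ j, C(a + j, i) C(m, j)`. -/
def shiftedChooseSum (a i m : ℕ) : ℤ :=
  ∑ j ∈ Finset.range (m + 1), ((a + j).choose i : ℤ) * (m.choose j : ℤ)

lemma shiftedChooseSum_succ_right (a i m : ℕ) :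
    shiftedChooseSum a i (m + 1) = shiftedChooseSum a i m + shiftedChooseSum (a + 1) i m := by
  have h : shiftedChooseSum a i m =
      ∑ j ∈ Finset.range (m + 2), ((a + j).choose i : ℤ) * (m.choose j : ℤ) := by
    rw [Finset.sum_range_succ]
    simp [shiftedChooseSum]
  rw [h, shiftedChooseSum, shiftedChooseSum, Finset.sum_range_succ', Finset.sum_range_succ' _ (m + 1),
    add_right_comm, ← Finset.sum_add_distrib]
  congr 1
  · refine Finset.sum_congr rfl fun j _ => ?_
    rw [Nat.choose_succ_succ, show a + 1 + j = a + (j + 1) by ring]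
    push_cast
    ring
  · simp

lemma shiftedChooseSum_succ_succ (a i m : ℕ) :
    shiftedChooseSum (a + 1) (i + 1) m =
      shiftedChooseSum a i m + shiftedChooseSum a (i + 1) m := by
  simp only [shiftedChooseSum, ← Finset.sum_add_distrib]
  refine Finset.sum_congr rfl fun j _ => ?_
  rw [add_right_comm, Nat.choose_succ_succ]
  push_cast
  ring

lemma coeff_self_charpoly_uht (t : ℕ → ℤ) (n : ℕ) : (uht t n).charpoly.coeff n = 1 := by
  have h := (uht t n).charpoly_monic.coeff_natDegree
  rwa [charpoly_natDegree_eq_dim, Fintype.card_fin] at h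

lemma coeff_zero_charpoly_uht_neg_one (m : ℕ) :
    (uht (fun _ => -1) (m + 1)).charpoly.coeff 0 = shiftedChooseSum 1 0 m := by
  induction m with
  | zero => simp [Matrix.charpoly, uht, shiftedChooseSum]
  | succ m ih =>
    rw [charpoly_uht_neg_one_succ_succ, shiftedChooseSum_succ_right]
    have h : shiftedChooseSum (1 + 1) 0 m = shiftedChooseSum 1 0 m := by simp [shiftedChooseSum]
    rw [h, ← ih]
    simp [mul_coeff_zero]
    ring

lemma coeff_succ_charpoly_uht_neg_one (n k : ℕ) :
    (uht (fun _ => -1) (n + 2)).charpoly.coeff (k + 1) =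
      (uht (fun _ => -1) (n + 1)).charpoly.coeff k +
        2 * (uht (fun _ => -1) (n + 1)).charpoly.coeff (k + 1) -
        (uht (fun _ => -1) n).charpoly.coeff k := by
  rw [charpoly_uht_neg_one_succ_succ, add_mul, coeff_sub, coeff_add, coeff_X_mul, coeff_X_mul,
    coeff_ofNat_mul]

lemma coeff_charpoly_uht_neg_one (i m : ℕ) :
    (uht (fun _ => -1) (i + m + 1)).charpoly.coeff i = shiftedChooseSum (i + 1) i m := by
  induction i generalizing m with
  | zero => rw [zero_add, zero_add, coeff_zero_charpoly_uht_neg_one]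
  | succ i ihi =>
    induction m with
    | zero =>
      have h := ihi 0
      rw [add_zero] at h ⊢
      rw [coeff_succ_charpoly_uht_neg_one, h, coeff_self_charpoly_uht, coeff_self_charpoly_uht]
      simp [shiftedChooseSum]
      ring
    | succ m ihm =>
      have h1 := ihi m
      have h2 := ihi (m + 1)
      rw [show i + 1 + m + 1 = i + (m + 1) + 1 by ring] at ihm
      rw [show i + 1 + (m + 1) + 1 = i + (m + 1) + 2 by ring,
        coeff_succ_charpoly_uht_neg_one, h2, ihm, ← add_assoc, h1]
      rw [shiftedChooseSum_succ_right, shiftedChooseSum_succ_right,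
        shiftedChooseSum_succ_succ (i + 1 + 1)]
      ring

theorem uht_neg_one_coeff_binomial (i : ℕ) :
    (∀ n : ℕ, 1 ≤ n →
      ((uht (fun _ => -1) (i + n)).charpoly).coeff i =
        ∑ j ∈ Finset.range n, ((i + j + 1).choose i : ℤ) * ((n - 1).choose j : ℤ)) ∧
    ((uht (fun _ => -1) i).charpoly).coeff i = 1 := by
  refine ⟨fun n hn => ?_, coeff_self_charpoly_uht _ i⟩
  obtain ⟨m, rfl⟩ := Nat.exists_eq_add_of_le' hn
  rw [← add_assoc, coeff_charpoly_uht_neg_one, shiftedChooseSum]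
  refine Finset.sum_congr rfl fun j _ => ?_
  rw [add_right_comm, Nat.add_sub_cancel]
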